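/- There is no distinct DNF tautology on 5 boolean variables all of whose cubes have length exactly 3, even though the density bound (5 choose 3) · 2^(5−3) = 40 ≥ 2^5 = 32 does not forbid it. -/

import Mathlib

abbrev Cube (n : ℕ) := Finset (Fin n) × (Fin n → Bool)

def Sat {n : ℕ} (a : Fin n → Bool) (c : Cube n) : Prop :=
  ∀ i ∈ c.1, a i = c.2 i

def DistinctDNF {n : ℕ} (D : Finset (Cube n)) : Prop :=
  ∀ c ∈ D, ∀ c' ∈ D, c.1 = c'.1 → c = c'

def Tauto {n : ℕ} (D : Finset (Cube n)) : Prop :=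
  ∀ a : Fin n → Bool, ∃ c ∈ D, Sat a c

/-! ### Characters of the boolean cube -/

/-- The sign of a truth value. -/
def boolSign (b : Bool) : ℤ := bif b then -1 else 1

lemma boolSign_xor (b c : Bool) : boolSign (b ^^ c) = boolSign b * boolSign c := by
  cases b <;> cases c <;> rfl

lemma boolSign_mul_self (b : Bool) : boolSign b * boolSign b = 1 := by cases b <;> rfl

lemma boolSign_eq_neg_one {b : Bool} : boolSign b = -1 ↔ b = true := by cases b <;> decide

lemma boolSign_eq_one {b : Bool} : boolSign b = 1 ↔ b = false := by cases b <;> decide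

section Character

variable {ι : Type*}

/-- The Walsh character of the boolean cube attached to a set of coordinates. -/
def walsh (S : Finset ι) (a : ι → Bool) : ℤ := ∏ i ∈ S, boolSign (a i)

lemma walsh_mul_self (S : Finset ι) (a : ι → Bool) : walsh S a * walsh S a = 1 := by
  simp [walsh, ← Finset.prod_mul_distrib, boolSign_mul_self]

lemma walsh_eq_one_or_neg_one (S : Finset ι) (a : ι → Bool) : walsh S a = 1 ∨ walsh S a = -1 :=
  mul_self_eq_one_iff.mp (walsh_mul_self S a)

variable [Fintype ι] [DecidableEq ι]

lemma walsh_univ_mul (S : Finset ι) (a : ι → Bool) :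
    walsh Finset.univ a * walsh S a = walsh Sᶜ a := by
  have h : walsh S a * walsh Sᶜ a = walsh Finset.univ a := Finset.prod_mul_prod_compl S _
  rw [← h, mul_right_comm, walsh_mul_self, one_mul]

/-- A character sums to zero over a subcube unless it is constant there. -/
lemma sum_walsh_subcube (S T : Finset ι) (f : ι → Bool) :
    ∑ a : ι → Bool, (if ∀ i ∈ T, a i = f i then walsh S a else 0) =
      if S ⊆ T then 2 ^ (Fintype.card ι - T.card) * walsh S f else 0 := by
  have hprod (a : ι → Bool) : (if ∀ i ∈ T, a i = f i then walsh S a else 0) =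
      ∏ i, (if i ∈ T → a i = f i then (if i ∈ S then boolSign (a i) else 1) else 0) := by
    rw [Finset.prod_ite_zero]
    simp [walsh]
  have hfactor (i : ι) :
      ∑ b, (if i ∈ T → b = f i then (if i ∈ S then boolSign b else 1) else 0) =
        (if i ∈ T then 1 else if i ∈ S then 0 else 2) * (if i ∈ S then boolSign (f i) else 1) := by
    by_cases hT : i ∈ T <;> by_cases hS : i ∈ S <;> simp [hT, hS, boolSign]
  simp_rw [hprod]
  rw [← Fintype.prod_sum (fun i b ↦
    if i ∈ T → b = f i then (if i ∈ S then boolSign b else 1) else 0)]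
  simp_rw [hfactor]
  rw [Finset.prod_mul_distrib]
  have hwalsh : ∏ i, (if i ∈ S then boolSign (f i) else 1) = walsh S f := by simp [walsh]
  rw [hwalsh]
  split_ifs with hST
  · congr 1
    rw [← Finset.card_compl, ← Finset.prod_const, ← Finset.prod_mul_prod_compl T,
      Finset.prod_eq_one (s := T) (by simp +contextual), one_mul]
    refine Finset.prod_congr rfl fun i hi ↦ ?_
    have hi' : i ∉ T := by simpa using hi
    rw [if_neg hi', if_neg fun h ↦ hi' (hST h)]
  · obtain ⟨i, hS, hT⟩ := Finset.not_subset.mp hST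
    rw [Finset.prod_eq_zero (Finset.mem_univ i) (by simp [hS, hT]), zero_mul]

lemma sum_walsh (S : Finset ι) :
    ∑ a : ι → Bool, walsh S a = if S = ∅ then 2 ^ Fintype.card ι else 0 := by
  have h := sum_walsh_subcube S ∅ fun _ ↦ false
  simp only [Finset.notMem_empty, false_imp_iff, implies_true, if_true, Finset.card_empty,
    Finset.subset_empty] at h
  rw [h]
  split_ifs with hS
  · simp [hS, walsh]
  · rfl

end Character

/-! ### Excess multiplicities of a covering by subcubes -/

/-- In a distinct DNF with cubes of length `k`, at most one sign pattern occurs on each support,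
so the sign patterns can be listed by support. -/
lemma exists_pattern {n k : ℕ} {D : Finset (Cube n)} (hD : DistinctDNF D) (hT : Tauto D)
    (hk : ∀ c ∈ D, c.1.card = k) :
    ∃ f : Finset (Fin n) → Fin n → Bool,
      ∀ a : Fin n → Bool, ∃ T ∈ Finset.univ.powersetCard k, ∀ i ∈ T, a i = f T i := by
  classical
  refine ⟨fun T ↦ if h : ∃ c ∈ D, c.1 = T then h.choose.2 else fun _ ↦ false, fun a ↦ ?_⟩
  obtain ⟨c, hc, hac⟩ := hT a
  refine ⟨c.1, by simp [hk c hc], ?_⟩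
  have h : ∃ c' ∈ D, c'.1 = c.1 := ⟨c, hc, rfl⟩
  have hchoose : h.choose = c := hD _ h.choose_spec.1 _ hc h.choose_spec.2
  beta_reduce
  rw [dif_pos h, hchoose]
  exact hac

/-- The numbers of superfluous coverings of the assignments by a tautology with all ten supports
of size three have prescribed character sums of high degree. -/
lemma exists_excess {f : Finset (Fin 5) → Fin 5 → Bool}
    (hf : ∀ a : Fin 5 → Bool, ∃ T ∈ Finset.univ.powersetCard 3, ∀ i ∈ T, a i = f T i) :
    ∃ e : (Fin 5 → Bool) → ℕ, ∑ a, (e a : ℤ) = 8 ∧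
      (∀ S : Finset (Fin 5), 4 ≤ S.card → ∑ a, (e a : ℤ) * walsh S a = 0) ∧
      ∀ S : Finset (Fin 5), S.card = 3 →
        ∑ a, (e a : ℤ) * walsh S a = 4 ∨ ∑ a, (e a : ℤ) * walsh S a = -4 := by
  let cov (a : Fin 5 → Bool) : ℕ :=
    ((Finset.univ.powersetCard 3).filter fun T ↦ ∀ i ∈ T, a i = f T i).card
  have hcov (a : Fin 5 → Bool) : 1 ≤ cov a := by
    obtain ⟨T, hT, ha⟩ := hf a
    exact Finset.card_pos.mpr ⟨T, Finset.mem_filter.mpr ⟨hT, ha⟩⟩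
  have hsum (S : Finset (Fin 5)) : ∑ a, (cov a : ℤ) * walsh S a =
      ∑ T ∈ Finset.univ.powersetCard 3, if S ⊆ T then 4 * walsh S (f T) else 0 := by
    have hcast (a : Fin 5 → Bool) : (cov a : ℤ) * walsh S a =
        ∑ T ∈ Finset.univ.powersetCard 3, if ∀ i ∈ T, a i = f T i then walsh S a else 0 := by
      rw [← Finset.sum_filter, Finset.sum_const, nsmul_eq_mul]
    simp_rw [hcast]
    rw [Finset.sum_comm]
    refine Finset.sum_congr rfl fun T hT ↦ ?_
    have h := sum_walsh_subcube S T (f T)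
    rw [(Finset.mem_powersetCard.mp hT).2, Fintype.card_fin] at h
    convert h using 3
    norm_num
  have hexcess (S : Finset (Fin 5)) : ∑ a, ((cov a - 1 : ℕ) : ℤ) * walsh S a =
      (∑ T ∈ Finset.univ.powersetCard 3, if S ⊆ T then 4 * walsh S (f T) else 0) -
        if S = ∅ then 32 else 0 := by
    have h := sum_walsh S
    rw [Fintype.card_fin] at h
    norm_num at h
    rw [← hsum, ← h, ← Finset.sum_sub_distrib]
    refine Finset.sum_congr rfl fun a _ ↦ ?_
    rw [Nat.cast_sub (hcov a)]
    push_cast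
    ring
  refine ⟨fun a ↦ cov a - 1, ?_, fun S hS ↦ ?_, fun S hS ↦ ?_⟩
  · have h := hexcess ∅
    simp only [walsh, Finset.prod_empty, mul_one, Finset.empty_subset, if_true, Finset.sum_const,
      Finset.card_powersetCard, Finset.card_univ, Fintype.card_fin] at h
    rw [h]
    decide
  · rw [hexcess, if_neg (by rintro rfl; simp at hS), sub_zero]
    refine Finset.sum_eq_zero fun T hT ↦ if_neg fun hST ↦ ?_
    have := Finset.card_le_card hST
    have := (Finset.mem_powersetCard.mp hT).2
    lia
  · rw [hexcess, if_neg (by rintro rfl; simp at hS), sub_zero, Finset.sum_eq_single S]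
    · rw [if_pos subset_rfl]
      rcases walsh_eq_one_or_neg_one S (f S) with h | h <;> simp [h]
    · intro T hT hne
      refine if_neg fun hST ↦ hne ?_
      exact (Finset.eq_of_subset_of_card_le hST
        (by rw [hS, (Finset.mem_powersetCard.mp hT).2])).symm
    · simp [hS]

/-- A family of multiplicities is the fibre count of a family of points. -/
lemma exists_fin_sum_eq {α : Type*} [Fintype α] (w : α → ℕ) {n : ℕ} (hn : ∑ a, w a = n) :
    ∃ x : Fin n → α, ∀ φ : α → ℤ, ∑ k, φ (x k) = ∑ a, (w a : ℤ) * φ a := by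
  let E : Fin n ≃ Σ a, Fin (w a) := Fintype.equivOfCardEq (by simp [hn])
  refine ⟨fun k ↦ (E k).1, fun φ ↦ ?_⟩
  rw [E.sum_comp fun p ↦ φ p.1, Fintype.sum_sigma]
  simp

/-- Eight points of the cube, four even and four odd, carrying the excess multiplicities. -/
lemma exists_even_odd_points {e : (Fin 5 → Bool) → ℕ} (he : ∑ a, (e a : ℤ) = 8)
    (he₀ : ∑ a, (e a : ℤ) * walsh Finset.univ a = 0) :
    ∃ x y : Fin 4 → Fin 5 → Bool, (∀ k, walsh Finset.univ (x k) = 1) ∧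
      (∀ k, walsh Finset.univ (y k) = -1) ∧
      ∀ S, ∑ k, walsh S (x k) - ∑ k, walsh S (y k) = ∑ a, (e a : ℤ) * walsh Sᶜ a := by
  let part (s : ℤ) (a : Fin 5 → Bool) : ℕ := if walsh Finset.univ a = s then e a else 0
  have hcard : ∑ a, (part 1 a : ℤ) + ∑ a, (part (-1) a : ℤ) = 8 ∧
      ∑ a, (part 1 a : ℤ) - ∑ a, (part (-1) a : ℤ) = 0 := by
    rw [← he, ← he₀, ← Finset.sum_add_distrib, ← Finset.sum_sub_distrib]
    constructor <;> refine Finset.sum_congr rfl fun a _ ↦ ?_ <;>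
      rcases walsh_eq_one_or_neg_one Finset.univ a with h | h <;> simp [part, h]
  have hx : ∑ a, part 1 a = 4 := by zify; lia
  have hy : ∑ a, part (-1) a = 4 := by zify; lia
  have hpart {s : ℤ} {x : Fin 4 → Fin 5 → Bool}
      (hx : ∀ φ : (Fin 5 → Bool) → ℤ, ∑ k, φ (x k) = ∑ a, (part s a : ℤ) * φ a) (k : Fin 4) :
      walsh Finset.univ (x k) = s := by
    have h := hx fun a ↦ if walsh Finset.univ a = s then 0 else 1
    rw [Finset.sum_eq_zero (s := Finset.univ (α := Fin 5 → Bool))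
      (by intro a _; by_cases h : walsh Finset.univ a = s <;> simp [part, h]),
      Finset.sum_eq_zero_iff_of_nonneg (by intro k _; split_ifs <;> simp)] at h
    simpa using h k (Finset.mem_univ k)
  obtain ⟨x, hx⟩ := exists_fin_sum_eq _ hx
  obtain ⟨y, hy⟩ := exists_fin_sum_eq _ hy
  refine ⟨x, y, hpart hx, hpart hy, fun S ↦ ?_⟩
  rw [hx, hy, ← Finset.sum_sub_distrib]
  refine Finset.sum_congr rfl fun a _ ↦ ?_
  rw [← walsh_univ_mul]
  rcases walsh_eq_one_or_neg_one Finset.univ a with h | h <;> simp [part, h]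

/-! ### Rows of signs -/

/-- The inner product of a row of eight signs with the all-ones row, for the form of
signature `(4, 4)`. -/
def signature (r : BitVec 8) : ℤ :=
  boolSign r[0] + boolSign r[1] + boolSign r[2] + boolSign r[3] -
    (boolSign r[4] + boolSign r[5] + boolSign r[6] + boolSign r[7])

/-- Two rows are compatible if their inner product for the form of signature `(4, 4)` is
`4` or `-4`. -/
def Compatible (r s : BitVec 8) : Prop := signature (r ^^^ s) = 4 ∨ signature (r ^^^ s) = -4

instance : DecidableRel Compatible := fun _ _ ↦ inferInstanceAs (Decidable (_ ∨ _))

/-- Search for `n` pairwise compatible rows among the candidates `L` with sum `t`. -/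
def searchRows : ℕ → BitVec 8 → List (BitVec 8) → Bool
  | 0, t, _ => t == 0
  | n + 1, t, L => L.any fun r ↦ searchRows n (t ^^^ r) (L.filter fun s ↦ Compatible r s)

lemma searchRows_eq_true (rows L : List (BitVec 8)) (hL : ∀ r ∈ rows, r ∈ L)
    (hrows : rows.Pairwise Compatible) :
    searchRows rows.length (rows.foldr (· ^^^ ·) 0) L = true := by
  induction rows generalizing L with
  | nil => rfl
  | cons r rows ih =>
    rw [List.pairwise_cons] at hrows
    rw [List.length_cons, searchRows, List.any_eq_true]
    refine ⟨r, hL r (by simp), ?_⟩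
    rw [List.foldr_cons, BitVec.xor_comm r, BitVec.xor_assoc, BitVec.xor_self, BitVec.xor_zero]
    refine ih _ (fun s hs ↦ ?_) hrows.2
    simp [hL s (by simp [hs]), hrows.1 s hs]

/-- The rows starting with a plus sign and having signature zero. -/
def balancedRows : List (BitVec 8) :=
  ((List.range 256).map (BitVec.ofNat 8)).filter fun r ↦ r[0] = false ∧ signature r = 0

lemma mem_balancedRows {r : BitVec 8} (h₀ : r[0] = false) (h : signature r = 0) :
    r ∈ balancedRows := by
  rw [balancedRows, List.mem_filter, List.mem_map]
  exact ⟨⟨r.toNat, List.mem_range.mpr r.isLt, by simp⟩, by simp [h₀, h]⟩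

lemma searchRows_balancedRows : searchRows 5 240 balancedRows = false := by
  decide +kernel

/-- The row of the `i`-th coordinates of eight points, translated so that the first point becomes
the origin. -/
def coordRow {ι : Type*} (x y : Fin 4 → ι → Bool) (i : ι) : BitVec 8 :=
  BitVec.ofFnLE (Fin.append (fun k ↦ x k i ^^ x 0 i) (fun k ↦ y k i ^^ x 0 i))

section CoordRow

variable {ι : Type*} (x y : Fin 4 → ι → Bool) (i : ι)

lemma coordRow_getElem_left (k : Fin 4) : (coordRow x y i)[(k : ℕ)] = (x k i ^^ x 0 i) := by
  rw [coordRow, BitVec.getElem_ofFnLE]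
  exact Fin.append_left _ _ k

lemma coordRow_getElem_right (k : Fin 4) :
    (coordRow x y i)[4 + (k : ℕ)] = (y k i ^^ x 0 i) := by
  rw [coordRow, BitVec.getElem_ofFnLE]
  exact Fin.append_right _ _ k

lemma signature_eq_sum (r : BitVec 8) :
    signature r = ∑ k : Fin 4, boolSign r[(k : ℕ)] - ∑ k : Fin 4, boolSign r[4 + (k : ℕ)] := by
  simp [signature, Fin.sum_univ_four]

lemma signature_coordRow :
    signature (coordRow x y i) =
      (∑ k, walsh {i} (x k) - ∑ k, walsh {i} (y k)) * walsh {i} (x 0) := by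
  simp only [signature_eq_sum, coordRow_getElem_left, coordRow_getElem_right, boolSign_xor, walsh,
    Finset.prod_singleton, ← Finset.sum_mul, sub_mul]

lemma signature_coordRow_xor [DecidableEq ι] {i j : ι} (hij : i ≠ j) :
    signature (coordRow x y i ^^^ coordRow x y j) =
      (∑ k, walsh {i, j} (x k) - ∑ k, walsh {i, j} (y k)) * walsh {i, j} (x 0) := by
  simp only [signature_eq_sum, BitVec.getElem_xor, coordRow_getElem_left, coordRow_getElem_right,
    boolSign_xor, walsh, Finset.prod_pair hij, sub_mul, Finset.sum_mul]
  congr 1 <;> exact Finset.sum_congr rfl fun k _ ↦ by ring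

end CoordRow

lemma foldr_xor_coordRow {x y : Fin 4 → Fin 5 → Bool} (hx : ∀ k, walsh Finset.univ (x k) = 1)
    (hy : ∀ k, walsh Finset.univ (y k) = -1) :
    (List.ofFn (coordRow x y)).foldr (· ^^^ ·) 0 = 240 := by
  have hfold : (List.ofFn (coordRow x y)).foldr (· ^^^ ·) 0 = coordRow x y 0 ^^^
      (coordRow x y 1 ^^^ (coordRow x y 2 ^^^ (coordRow x y 3 ^^^ coordRow x y 4))) := by
    simp [List.ofFn_succ]
  have hparity (a b : Fin 5 → Bool) : boolSign ((a 0 ^^ b 0) ^^ ((a 1 ^^ b 1) ^^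
      ((a 2 ^^ b 2) ^^ ((a 3 ^^ b 3) ^^ (a 4 ^^ b 4))))) =
        walsh Finset.univ a * walsh Finset.univ b := by
    simp only [boolSign_xor, walsh, Fin.prod_univ_five]
    ring
  rw [hfold]
  have hleft (k : Fin 4) := boolSign_eq_one.mp ((hparity (x k) (x 0)).trans (by simp [hx]))
  have hright (k : Fin 4) := boolSign_eq_neg_one.mp ((hparity (y k) (x 0)).trans (by simp [hx, hy]))
  simp only [← coordRow_getElem_left x y, ← BitVec.getElem_xor] at hleft
  simp only [← coordRow_getElem_right x y, ← BitVec.getElem_xor] at hright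
  refine BitVec.eq_of_getElem_eq fun m hm ↦ ?_
  interval_cases m
  exacts [(hleft 0).trans (by simp), (hleft 1).trans (by simp), (hleft 2).trans (by simp),
    (hleft 3).trans (by simp), (hright 0).trans (by simp), (hright 1).trans (by simp),
    (hright 2).trans (by simp), (hright 3).trans (by simp)]

theorem stmt5 :
    (¬ ∃ D : Finset (Cube 5), DistinctDNF D ∧ Tauto D ∧ ∀ c ∈ D, c.1.card = 3)
    ∧ Nat.choose 5 3 * 2 ^ (5 - 3) ≥ 2 ^ 5 := by
  refine ⟨?_, by decide⟩
  rintro ⟨D, hD, hT, hcard⟩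
  obtain ⟨f, hf⟩ := exists_pattern hD hT hcard
  obtain ⟨e, he, he_high, he_three⟩ := exists_excess hf
  obtain ⟨x, y, hx, hy, hxy⟩ := exists_even_odd_points he (he_high _ (by simp))
  have hmem : ∀ r ∈ List.ofFn (coordRow x y), r ∈ balancedRows := by
    rw [List.forall_mem_ofFn_iff]
    intro i
    refine mem_balancedRows ?_ ?_
    · exact (coordRow_getElem_left x y i 0).trans (Bool.xor_self _)
    · rw [signature_coordRow, hxy, he_high _ (by simp [Finset.card_compl]), zero_mul]
  have hpair : (List.ofFn (coordRow x y)).Pairwise Compatible := by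
    rw [List.pairwise_ofFn]
    intro i j hij
    have hthree : ({i, j} : Finset (Fin 5))ᶜ.card = 3 := by
      rw [Finset.card_compl, Finset.card_pair hij.ne, Fintype.card_fin]
    rw [Compatible, signature_coordRow_xor x y hij.ne, hxy]
    rcases he_three _ hthree with h | h <;>
      rcases walsh_eq_one_or_neg_one {i, j} (x 0) with h' | h' <;> rw [h, h'] <;> decide
  have hsearch := searchRows_eq_true _ _ hmem hpair
  rw [foldr_xor_coordRow hx hy, List.length_ofFn, searchRows_balancedRows] at hsearch
  exact Bool.false_ne_true hsearch
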